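/- For every real x with 0 < x < 1, the function Ψ(k) = k/E(k) is differentiable at x with derivative Ψ'(x) = (E(x) − x·E'(x))/E(x)² = K(x)/E(x)². -/

import Mathlib

open MeasureTheory

/-- Complete Legendre elliptic integral of the second kind. -/
noncomputable def ellE (k : ℝ) : ℝ :=
  ∫ t in (0:ℝ)..1, Real.sqrt ((1 - k^2 * t^2) / (1 - t^2))

/-- Complete Legendre elliptic integral of the first kind. -/
noncomputable def ellK (k : ℝ) : ℝ :=
  ∫ t in (0:ℝ)..1, 1 / Real.sqrt ((1 - t^2) * (1 - k^2 * t^2))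

/-- The function `Ψ(k) = k / E(k)`. -/
noncomputable def PsiFn (k : ℝ) : ℝ := k / ellE k

/-- `Φ`, the inverse on `[0,1]` of the strictly increasing bijection `Ψ`. -/
noncomputable def PhiFn (x : ℝ) : ℝ :=
  sSup {y : ℝ | y ∈ Set.Icc (0:ℝ) 1 ∧ PsiFn y ≤ x}

/-- The function `𝒥(x) = (π²/4) ∫_{Φ(2x/π)}^1 dt/(t E(t)²)`. -/
noncomputable def Jcal (x : ℝ) : ℝ :=
  (Real.pi^2 / 4) * ∫ t in PhiFn (2*x/Real.pi)..(1:ℝ), 1 / (t * (ellE t)^2)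

/-- The function `𝒥_l(c) = (π/2) ∫_c^{πl/2} dτ/(Φ(2τ/(πl)) K(Φ(2τ/(πl))))`. -/
noncomputable def Jl (l c : ℝ) : ℝ :=
  (Real.pi / 2) * ∫ τ in c..(Real.pi * l / 2),
    1 / (PhiFn (2*τ/(Real.pi*l)) * ellK (PhiFn (2*τ/(Real.pi*l))))

/-- The approximation `λ̃_n(c)`. -/
noncomputable def lambdaTilde (n : ℕ) (c : ℝ) : ℝ :=
  (1/2) * Real.exp (-(Real.pi^2 * ((n:ℝ) + 1/2) / 2) *
    ∫ t in PhiFn (2*c/(Real.pi*((n:ℝ)+1/2)))..(1:ℝ), 1 / (t * (ellE t)^2))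

/-- The kernel `sin(c(x-y))/(π(x-y))`, with value `c/π` on the diagonal. -/
noncomputable def sincKernel (c x y : ℝ) : ℝ :=
  if x = y then c / Real.pi else Real.sin (c*(x-y)) / (Real.pi * (x-y))

/-- The quadratic form `⟨Q_c f, f⟩` of the time-and-frequency limiting operator `Q_c`. -/
noncomputable def QForm (c : ℝ) (f : ℝ → ℝ) : ℝ :=
  ∫ x in Set.Ioo (-1:ℝ) 1, ∫ y in Set.Ioo (-1:ℝ) 1, sincKernel c x y * f y * f x

/-- The `(n+1)`-st eigenvalue `λ_n(c)` of `Q_c`, via the Courant–Fischer min-max principle. -/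
noncomputable def lambda (n : ℕ) (c : ℝ) : ℝ :=
  ⨆ V : {V : Submodule ℝ (Lp ℝ 2 (volume.restrict (Set.Ioo (-1:ℝ) 1))) //
          Module.finrank ℝ V = n + 1},
    ⨅ f : {f : Lp ℝ 2 (volume.restrict (Set.Ioo (-1:ℝ) 1)) // f ∈ V.1 ∧ f ≠ 0},
      QForm c (f.1 : ℝ → ℝ) / ‖f.1‖^2

lemma intervalIntegrable_inv_sqrt_one_sub_sq :
    IntervalIntegrable (fun t : ℝ => (√(1 - t ^ 2))⁻¹) volume 0 1 := by
  have h : IntervalIntegrable (fun t : ℝ => √(1 - t ^ 2)⁻¹) volume (-1) 1 :=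
    Polynomial.Chebyshev.intervalIntegrable_sqrt_one_sub_sq_inv
  simp only [Real.sqrt_inv] at h
  exact h.mono_set (by
    rw [Set.uIcc_of_le (by norm_num), Set.uIcc_of_le (by norm_num)]
    exact Set.Icc_subset_Icc (by norm_num) le_rfl)

lemma one_sub_sq_mul_sq_pos {k t : ℝ} (hk : |k| < 1) (ht : t ∈ Set.Icc (0 : ℝ) 1) :
    0 < 1 - k ^ 2 * t ^ 2 := by
  have h1 : k ^ 2 < 1 := (sq_lt_one_iff_abs_lt_one k).2 hk
  have h2 : t ^ 2 ≤ 1 := pow_le_one₀ ht.1 ht.2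
  nlinarith [sq_nonneg k, sq_nonneg t]

lemma ellE_integrand_eq {k t : ℝ} (hk : |k| < 1) (ht : t ∈ Set.Icc (0 : ℝ) 1) :
    √((1 - k ^ 2 * t ^ 2) / (1 - t ^ 2)) = (√(1 - t ^ 2))⁻¹ * √(1 - k ^ 2 * t ^ 2) := by
  rw [Real.sqrt_div (one_sub_sq_mul_sq_pos hk ht).le, div_eq_inv_mul]

lemma ellK_integrand_eq {k t : ℝ} (ht : t ∈ Set.Icc (0 : ℝ) 1) :
    1 / √((1 - t ^ 2) * (1 - k ^ 2 * t ^ 2)) =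
      (√(1 - t ^ 2))⁻¹ * (√(1 - k ^ 2 * t ^ 2))⁻¹ := by
  rw [Real.sqrt_mul (sub_nonneg.2 (pow_le_one₀ ht.1 ht.2)), one_div, mul_inv]

lemma ellE_eq {k : ℝ} (hk : |k| < 1) :
    ellE k = ∫ t in (0 : ℝ)..1, (√(1 - t ^ 2))⁻¹ * √(1 - k ^ 2 * t ^ 2) := by
  refine intervalIntegral.integral_congr fun t ht => ?_
  rw [Set.uIcc_of_le zero_le_one] at ht
  exact ellE_integrand_eq hk ht

lemma ellK_eq (k : ℝ) :
    ellK k = ∫ t in (0 : ℝ)..1, (√(1 - t ^ 2))⁻¹ * (√(1 - k ^ 2 * t ^ 2))⁻¹ := by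
  refine intervalIntegral.integral_congr fun t ht => ?_
  rw [Set.uIcc_of_le zero_le_one] at ht
  exact ellK_integrand_eq ht

lemma intervalIntegrable_ellE_integrand (k : ℝ) :
    IntervalIntegrable (fun t : ℝ => (√(1 - t ^ 2))⁻¹ * √(1 - k ^ 2 * t ^ 2)) volume 0 1 :=
  intervalIntegrable_inv_sqrt_one_sub_sq.mul_continuousOn (by fun_prop)

lemma ellE_pos {k : ℝ} (hk : |k| < 1) : 0 < ellE k := by
  rw [ellE_eq hk]
  refine intervalIntegral.intervalIntegral_pos_of_pos_on
    (intervalIntegrable_ellE_integrand k) (fun t ht => ?_) one_pos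
  have h1 : 0 < 1 - t ^ 2 := sub_pos.2 (pow_lt_one₀ ht.1.le ht.2 two_ne_zero)
  have h2 := one_sub_sq_mul_sq_pos hk (Set.Ioo_subset_Icc_self ht)
  positivity

lemma hasDerivAt_ellE_integrand {k t : ℝ} (hk : |k| < 1) (ht : t ∈ Set.Icc (0 : ℝ) 1) :
    HasDerivAt (fun k : ℝ => (√(1 - t ^ 2))⁻¹ * √(1 - k ^ 2 * t ^ 2))
      ((√(1 - t ^ 2))⁻¹ * (-(k * t ^ 2) * (√(1 - k ^ 2 * t ^ 2))⁻¹)) k := by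
  have h := one_sub_sq_mul_sq_pos hk ht
  have h1 : HasDerivAt (fun k : ℝ => 1 - k ^ 2 * t ^ 2) (-(2 * k * t ^ 2)) k := by
    simpa using ((hasDerivAt_pow 2 k).mul_const (t ^ 2)).const_sub 1
  refine ((h1.sqrt h.ne').const_mul _).congr_deriv ?_
  have := (Real.sqrt_pos.2 h).ne'
  field_simp

lemma hasDerivAt_ellE {k : ℝ} (hk : |k| < 1) :
    IntervalIntegrable
      (fun t : ℝ => (√(1 - t ^ 2))⁻¹ * (-(k * t ^ 2) * (√(1 - k ^ 2 * t ^ 2))⁻¹)) volume 0 1 ∧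
    HasDerivAt ellE
      (∫ t in (0 : ℝ)..1, (√(1 - t ^ 2))⁻¹ * (-(k * t ^ 2) * (√(1 - k ^ 2 * t ^ 2))⁻¹)) k := by
  obtain ⟨r, hkr, hr⟩ := exists_between hk
  have hr0 : 0 ≤ r := (abs_nonneg k).trans hkr.le
  have hs : Set.Ioo (-r) r ∈ nhds k := Ioo_mem_nhds (abs_lt.1 hkr).1 (abs_lt.1 hkr).2
  have hIcc : ∀ t ∈ Set.uIoc (0 : ℝ) 1, t ∈ Set.Icc (0 : ℝ) 1 := fun t ht => by
    rw [Set.uIoc_of_le zero_le_one] at ht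
    exact Set.Ioc_subset_Icc_self ht
  have key := intervalIntegral.hasDerivAt_integral_of_dominated_loc_of_deriv_le
    (μ := volume) (a := 0) (b := 1)
    (F := fun k t : ℝ => (√(1 - t ^ 2))⁻¹ * √(1 - k ^ 2 * t ^ 2))
    (F' := fun k t : ℝ => (√(1 - t ^ 2))⁻¹ * (-(k * t ^ 2) * (√(1 - k ^ 2 * t ^ 2))⁻¹))
    (bound := fun t => (√(1 - t ^ 2))⁻¹ * (√(1 - r ^ 2))⁻¹)
    hs (.of_forall fun k => by fun_prop)
    (intervalIntegrable_ellE_integrand k) (by fun_prop)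
    (.of_forall fun t ht y hy => ?_)
    (intervalIntegrable_inv_sqrt_one_sub_sq.mul_const _)
    (.of_forall fun t ht y hy =>
      hasDerivAt_ellE_integrand ((abs_lt.2 hy).trans hr) (hIcc t ht))
  · refine ⟨key.1, key.2.congr_of_eventuallyEq ?_⟩
    filter_upwards [hs] with y hy
    exact ellE_eq ((abs_lt.2 hy).trans hr)
  · have hyr : |y| < r := abs_lt.2 hy
    have ht' := hIcc t ht
    have ht2 : t ^ 2 ≤ 1 := pow_le_one₀ ht'.1 ht'.2
    have hr1 : 0 < 1 - r ^ 2 := sub_pos.2 (pow_lt_one₀ hr0 hr two_ne_zero)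
    have hy2 : y ^ 2 ≤ r ^ 2 := sq_le_sq' hy.1.le hy.2.le
    have hle : 1 - r ^ 2 ≤ 1 - y ^ 2 * t ^ 2 := by nlinarith [sq_nonneg y]
    have hnum : |y| * t ^ 2 ≤ 1 :=
      mul_le_one₀ (hyr.trans hr).le (sq_nonneg t) ht2
    rw [norm_mul, norm_mul, norm_neg, norm_inv, norm_inv, Real.norm_of_nonneg (Real.sqrt_nonneg _),
      Real.norm_of_nonneg (Real.sqrt_nonneg _), norm_mul, Real.norm_eq_abs,
      Real.norm_of_nonneg (sq_nonneg t)]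
    refine mul_le_mul_of_nonneg_left ?_ (by positivity)
    calc |y| * t ^ 2 * (√(1 - y ^ 2 * t ^ 2))⁻¹ ≤ 1 * (√(1 - y ^ 2 * t ^ 2))⁻¹ := by gcongr
      _ ≤ (√(1 - r ^ 2))⁻¹ := by rw [one_mul]; gcongr

lemma ellE_sub_mul_deriv {k : ℝ} (hk : |k| < 1) : ellE k - k * deriv ellE k = ellK k := by
  obtain ⟨hint, hd⟩ := hasDerivAt_ellE hk
  rw [hd.deriv, ellE_eq hk, ellK_eq, ← intervalIntegral.integral_const_mul,
    ← intervalIntegral.integral_sub (intervalIntegrable_ellE_integrand k) (hint.const_mul k)]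
  refine intervalIntegral.integral_congr fun t ht => ?_
  rw [Set.uIcc_of_le zero_le_one] at ht
  have h := one_sub_sq_mul_sq_pos hk ht
  have h0 := (Real.sqrt_pos.2 h).ne'
  have h2 : √(1 - k ^ 2 * t ^ 2) =
      (1 - k ^ 2 * t ^ 2) * (√(1 - k ^ 2 * t ^ 2))⁻¹ := by
    rw [← div_eq_mul_inv, Real.div_sqrt]
  linear_combination (√(1 - t ^ 2))⁻¹ * h2

theorem stmt13 (x : ℝ) (hx : 0 < x) (hx1 : x < 1) :
    HasDerivAt PsiFn ((ellE x - x * deriv ellE x) / (ellE x)^2) x ∧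
    (ellE x - x * deriv ellE x) / (ellE x)^2 = ellK x / (ellE x)^2 := by
  have hk : |x| < 1 := by rwa [abs_of_pos hx]
  have hd := (hasDerivAt_ellE hk).2.differentiableAt.hasDerivAt
  refine ⟨?_, by rw [ellE_sub_mul_deriv hk]⟩
  exact ((hasDerivAt_id x).fun_div hd (ellE_pos hk).ne').congr_deriv (by simp)
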